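/- Let S and Z be random variables on finite alphabets with joint distribution P_{S,Z}, and let ε satisfy 0 ≤ ε ≤ H(S). If H(S|Z) = 0 (i.e., S is a deterministic function of Z), then the upper and lower bounds of Theorem 1 coincide and h_ε(P_{S,Z}) = H(Z|S) + ε; that is, there exists U with I(U;S) ≤ ε and I(U;Z) = H(Z|S) + ε, and no U with I(U;S) ≤ ε achieves more. -/

import Mathlib

open MeasureTheory ProbabilityTheory

/-- Shannon entropy (natural logarithm) of a random variable `X`
taking values in a finite alphabet `α`. -/
noncomputable def infH {Ω : Type*} [MeasurableSpace Ω] {α : Type*} [Fintype α]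
    (P : Measure Ω) (X : Ω → α) : ℝ :=
  ∑ a : α, Real.negMulLog (P (X ⁻¹' {a})).toReal

/-- Conditional Shannon entropy `H(X | Y)`. -/
noncomputable def infCondH {Ω : Type*} [MeasurableSpace Ω] {α β : Type*} [Fintype α] [Fintype β]
    (P : Measure Ω) (X : Ω → α) (Y : Ω → β) : ℝ :=
  infH P (fun ω => (X ω, Y ω)) - infH P Y

/-- Mutual information `I(X ; Y)`. -/
noncomputable def infMI {Ω : Type*} [MeasurableSpace Ω] {α β : Type*} [Fintype α] [Fintype β]
    (P : Measure Ω) (X : Ω → α) (Y : Ω → β) : ℝ :=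
  infH P X + infH P Y - infH P (fun ω => (X ω, Y ω))

/-- Conditional mutual information `I(X ; Y | Z)`. -/
noncomputable def infCMI {Ω : Type*} [MeasurableSpace Ω] {α β γ : Type*}
    [Fintype α] [Fintype β] [Fintype γ]
    (P : Measure Ω) (X : Ω → α) (Y : Ω → β) (Z : Ω → γ) : ℝ :=
  infCondH P X Z + infCondH P Y Z - infCondH P (fun ω => (X ω, Y ω)) Z

/-- The privacy–utility trade-off `h_ε(P_{S,Z})`: the supremum of `I(U;Z)` over all
random variables `U` (with finite alphabet), defined on some probability space carrying a
copy of `(S,Z)` with joint distribution `μ`, subject to the leakage constraint `I(U;S) ≤ ε`. -/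
noncomputable def hEps {σ ζ : Type} [Fintype σ] [MeasurableSpace σ] [MeasurableSingletonClass σ]
    [Fintype ζ] [MeasurableSpace ζ] [MeasurableSingletonClass ζ]
    (μ : Measure (σ × ζ)) (ε : ℝ) : ℝ :=
  sSup { r : ℝ | ∃ (Ω : Type) (_ : MeasurableSpace Ω) (P : Measure Ω)
    (_ : IsProbabilityMeasure P) (Sv : Ω → σ) (Zv : Ω → ζ) (n : ℕ) (U : Ω → Fin n),
    Measurable Sv ∧ Measurable Zv ∧ Measurable U ∧
    P.map (fun ω => (Sv ω, Zv ω)) = μ ∧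
    infMI P U Sv ≤ ε ∧ r = infMI P U Zv }

lemma measure_mul_log_sub_log_nonneg {Ω α β : Type*} [MeasurableSpace Ω]
    (P : Measure Ω) [IsFiniteMeasure P] (X : Ω → α)
    (g : α → β) (a : α) : 0 ≤ (P (X ⁻¹' {a})).toReal *
      (Real.log (P ((fun ω => g (X ω)) ⁻¹' {g a})).toReal - Real.log (P (X ⁻¹' {a})).toReal) := by
  rcases eq_or_lt_of_le (ENNReal.toReal_nonneg (a := P (X ⁻¹' {a}))) with h | h
  · rw [← h, zero_mul]
  · refine mul_nonneg h.le (sub_nonneg.mpr (Real.log_le_log h ?_))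
    refine ENNReal.toReal_mono (measure_ne_top _ _) (measure_mono fun ω hω => ?_)
    simp_all

section Entropy

variable {Ω : Type*} [MeasurableSpace Ω] {α β : Type*} [Fintype α] [Fintype β]

lemma infH_congr_ae {P : Measure Ω} {X Y : Ω → α} (h : X =ᵐ[P] Y) : infH P X = infH P Y := by
  unfold infH
  refine Finset.sum_congr rfl fun a _ => ?_
  rw [measure_congr (h.preimage {a})]

lemma infH_comp_of_injective (P : Measure Ω) (X : Ω → α) {g : α → β}
    (hg : Function.Injective g) : infH P (fun ω => g (X ω)) = infH P X := by
  unfold infH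
  symm
  refine Fintype.sum_of_injective g hg _ _ (fun b hb => ?_) (fun a => ?_)
  · have : (fun ω => g (X ω)) ⁻¹' {b} = ∅ := by
      ext ω
      simp only [Set.mem_preimage, Set.mem_singleton_iff, Set.mem_empty_iff_false, iff_false]
      exact fun h => hb ⟨X ω, h⟩
    simp [this]
  · congr 3
    ext ω
    simp [hg.eq_iff]

lemma infH_map {Ω' : Type*} [MeasurableSpace Ω'] [Countable Ω'] [MeasurableSingletonClass Ω']
    (P : Measure Ω) {X : Ω → Ω'} (hX : Measurable X) (Y : Ω' → α) :
    infH (P.map X) Y = infH P (fun ω => Y (X ω)) := by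
  unfold infH
  refine Finset.sum_congr rfl fun a _ => ?_
  rw [Measure.map_apply hX (Set.to_countable _).measurableSet]
  rfl

lemma sum_toReal_preimage_singleton_eq_one [MeasurableSpace α] [MeasurableSingletonClass α]
    (P : Measure Ω) [IsProbabilityMeasure P] {X : Ω → α} (hX : Measurable X) :
    ∑ a, (P (X ⁻¹' {a})).toReal = 1 := by
  have := sum_measureReal_preimage_singleton (μ := P) (f := X) Finset.univ
    (fun a _ => hX (measurableSet_singleton a))
  simpa [measureReal_def] using this

lemma infH_prodMk_of_indepFun [MeasurableSpace α] [MeasurableSingletonClass α]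
    [MeasurableSpace β] [MeasurableSingletonClass β] (P : Measure Ω) [IsProbabilityMeasure P]
    {X : Ω → α} {Y : Ω → β} (hX : Measurable X) (hY : Measurable Y) (h : IndepFun X Y P) :
    infH P (fun ω => (X ω, Y ω)) = infH P X + infH P Y := by
  have hjoint (a : α) (b : β) : (P ((fun ω => (X ω, Y ω)) ⁻¹' {(a, b)})).toReal
      = (P (X ⁻¹' {a})).toReal * (P (Y ⁻¹' {b})).toReal := by
    rw [← ENNReal.toReal_mul, ← h.measure_inter_preimage_eq_mul _ _ (measurableSet_singleton a)
      (measurableSet_singleton b)]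
    congr 2
    ext ω
    simp
  unfold infH
  simp only [Fintype.sum_prod_type, hjoint, Real.negMulLog_mul, Finset.sum_add_distrib,
    ← Finset.sum_mul, ← Finset.mul_sum, sum_toReal_preimage_singleton_eq_one P hX,
    sum_toReal_preimage_singleton_eq_one P hY, one_mul]

lemma infH_sub_infH_comp [MeasurableSpace α] [MeasurableSingletonClass α]
    (P : Measure Ω) [IsFiniteMeasure P] {X : Ω → α} (hX : Measurable X) (g : α → β) :
    infH P X - infH P (fun ω => g (X ω)) = ∑ a, (P (X ⁻¹' {a})).toReal *
      (Real.log (P ((fun ω => g (X ω)) ⁻¹' {g a})).toReal - Real.log (P (X ⁻¹' {a})).toReal) := by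
  classical
  have hfib (b : β) : (P ((fun ω => g (X ω)) ⁻¹' {b})).toReal
      = ∑ a with g a = b, (P (X ⁻¹' {a})).toReal := by
    have := sum_measureReal_preimage_singleton (μ := P) (f := X) (Finset.univ.filter (g · = b))
      (fun a _ => hX (measurableSet_singleton a))
    simp only [measureReal_def] at this
    rw [this]
    congr 2
    ext ω
    simp
  have hg : infH P (fun ω => g (X ω)) = ∑ a, -((P (X ⁻¹' {a})).toReal *
      Real.log (P ((fun ω => g (X ω)) ⁻¹' {g a})).toReal) := by
    rw [← Finset.sum_fiberwise Finset.univ g]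
    unfold infH
    refine Finset.sum_congr rfl fun b _ => ?_
    rw [Real.negMulLog, neg_mul, Finset.sum_neg_distrib]
    nth_rewrite 1 [hfib b]
    rw [Finset.sum_mul]
    congr 1
    refine Finset.sum_congr rfl fun a ha => ?_
    rw [(Finset.mem_filter.mp ha).2]
  rw [hg, infH, ← Finset.sum_sub_distrib]
  refine Finset.sum_congr rfl fun a _ => ?_
  rw [Real.negMulLog]
  ring

lemma infH_comp_le [MeasurableSpace α] [MeasurableSingletonClass α]
    (P : Measure Ω) [IsFiniteMeasure P] {X : Ω → α} (hX : Measurable X) (g : α → β) :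
    infH P (fun ω => g (X ω)) ≤ infH P X := by
  rw [← sub_nonneg, infH_sub_infH_comp P hX g]
  exact Finset.sum_nonneg fun a _ => measure_mul_log_sub_log_nonneg P X g a

/-- If passing from `X` to `g ∘ X` loses no entropy, then every atom of `X` of positive mass
is the whole fibre of `g ∘ X` over its image. -/
lemma measure_comp_eq_of_infH_comp_eq [MeasurableSpace α] [MeasurableSingletonClass α]
    (P : Measure Ω) [IsFiniteMeasure P] {X : Ω → α} (hX : Measurable X) (g : α → β)
    (h : infH P X = infH P (fun ω => g (X ω))) {a : α} (ha : P (X ⁻¹' {a}) ≠ 0) :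
    P ((fun ω => g (X ω)) ⁻¹' {g a}) = P (X ⁻¹' {a}) := by
  have h0 := infH_sub_infH_comp P hX g
  rw [h, sub_self, eq_comm, Finset.sum_eq_zero_iff_of_nonneg
    fun a _ => measure_mul_log_sub_log_nonneg P X g a] at h0
  have hpos : 0 < (P (X ⁻¹' {a})).toReal := ENNReal.toReal_pos ha (measure_ne_top _ _)
  have hle : P (X ⁻¹' {a}) ≤ P ((fun ω => g (X ω)) ⁻¹' {g a}) :=
    measure_mono fun ω hω => by simp_all
  have hpos' : 0 < (P ((fun ω => g (X ω)) ⁻¹' {g a})).toReal :=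
    hpos.trans_le (ENNReal.toReal_mono (measure_ne_top _ _) hle)
  have hlog := (mul_eq_zero.mp (h0 a (Finset.mem_univ a))).resolve_left hpos.ne'
  exact (ENNReal.toReal_eq_toReal_iff' (measure_ne_top _ _) (measure_ne_top _ _)).mp
    (Real.log_injOn_pos hpos' hpos (sub_eq_zero.mp hlog))

lemma exists_ae_eq_of_infCondH_eq_zero [MeasurableSpace α] [MeasurableSingletonClass α]
    [MeasurableSpace β] [MeasurableSingletonClass β]
    (μ : Measure (α × β)) [IsProbabilityMeasure μ] (h : infCondH μ Prod.fst Prod.snd = 0) :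
    ∃ f : β → α, ∀ᵐ x ∂μ, x.1 = f x.2 := by
  have hH : infH μ (fun x : α × β => x) = infH μ (fun x : α × β => x.2) := sub_eq_zero.mp h
  have hatom (x : α × β) (hx : μ {x} ≠ 0) : μ (Prod.snd ⁻¹' {x.2}) = μ {x} :=
    measure_comp_eq_of_infH_comp_eq μ measurable_id Prod.snd hH hx
  obtain ⟨x₀⟩ := μ.nonempty_of_neZero
  have key (b : β) : ∃ a, ∀ a', μ {(a', b)} ≠ 0 → a' = a := by
    by_cases hb : ∃ a, μ {(a, b)} ≠ 0
    · obtain ⟨a, ha⟩ := hb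
      refine ⟨a, fun a' ha' => by_contra fun hne => ha' ?_⟩
      have hunion : μ {(a, b)} + μ {(a', b)} ≤ μ {(a, b)} + 0 := by
        rw [← measure_union (by simpa using Ne.symm hne) (measurableSet_singleton _), add_zero,
          ← hatom (a, b) ha]
        refine measure_mono ?_
        rintro x (rfl | rfl) <;> simp
      exact le_antisymm ((ENNReal.add_le_add_iff_left (measure_ne_top _ _)).mp hunion) zero_le
    · exact ⟨x₀.1, fun a' ha' => (hb ⟨a', ha'⟩).elim⟩
  choose f hf using key
  exact ⟨f, ae_iff_of_countable.mpr fun x hx => hf x.2 x.1 hx⟩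

end Entropy

/-- The measure on `Bool` giving mass `p` to `true` and `1 - p` to `false`. -/
noncomputable def coinMeasure (p : ℝ) : Measure Bool :=
  ENNReal.ofReal p • Measure.dirac true + ENNReal.ofReal (1 - p) • Measure.dirac false

lemma isProbabilityMeasure_coinMeasure {p : ℝ} (h0 : 0 ≤ p) (h1 : p ≤ 1) :
    IsProbabilityMeasure (coinMeasure p) :=
  ⟨by simp [coinMeasure, ← ENNReal.ofReal_add h0 (sub_nonneg.mpr h1)]⟩

lemma coinMeasure_true (p : ℝ) : coinMeasure p {true} = ENNReal.ofReal p := by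
  simp [coinMeasure]

lemma coinMeasure_false (p : ℝ) : coinMeasure p {false} = ENNReal.ofReal (1 - p) := by
  simp [coinMeasure]

/-- The output of an erasure channel: the input is revealed exactly when the flag is `true`. -/
def erase {α : Type*} (x : Bool × α) : Option α := if x.1 then some x.2 else none

lemma infMI_erase {α : Type*} [Fintype α] [MeasurableSpace α] [MeasurableSingletonClass α]
    (ν : Measure α) [IsProbabilityMeasure ν] {p : ℝ} (h0 : 0 ≤ p) (h1 : p ≤ 1) :
    infMI ((coinMeasure p).prod ν) erase Prod.snd = p * infH ν id := by
  have := isProbabilityMeasure_coinMeasure h0 h1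
  have hinj : Function.Injective (fun x : Bool × α => (erase x, x.2)) := by
    rintro ⟨_ | _, a⟩ ⟨_ | _, b⟩ <;> simp [erase]
  have hpair : infH ((coinMeasure p).prod ν) (fun x => (erase x, x.2))
      = infH (coinMeasure p) id + infH ((coinMeasure p).prod ν) Prod.snd := by
    rw [infH_comp_of_injective ((coinMeasure p).prod ν) (fun x => x) hinj]
    have hfst : infH ((coinMeasure p).prod ν) Prod.fst = infH (coinMeasure p) id := by
      have := infH_map ((coinMeasure p).prod ν) measurable_fst (id : Bool → Bool)
      rw [Measure.map_fst_prod, measure_univ, one_smul] at this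
      exact this.symm
    rw [← hfst]
    exact infH_prodMk_of_indepFun _ measurable_fst measurable_snd
      (indepFun_prod measurable_id measurable_id)
  have hsome (a : α) : erase ⁻¹' {some a} = {true} ×ˢ ({a} : Set α) := by
    ext ⟨_ | _, b⟩ <;> simp [erase]
  have hnone : erase ⁻¹' {none} = {false} ×ˢ (Set.univ : Set α) := by
    ext ⟨_ | _, b⟩ <;> simp [erase]
  have hsum : ∑ a, (ν {a}).toReal = 1 := sum_toReal_preimage_singleton_eq_one ν measurable_id
  rw [infMI, hpair]
  simp only [infH, Set.preimage_id, Fintype.sum_option, Fintype.sum_bool, hsome, hnone,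
    Measure.prod_prod, measure_univ, mul_one, coinMeasure_true, coinMeasure_false,
    ENNReal.toReal_mul, ENNReal.toReal_ofReal h0, ENNReal.toReal_ofReal (sub_nonneg.mpr h1),
    Real.negMulLog_mul, Finset.sum_add_distrib, ← Finset.sum_mul, ← Finset.mul_sum, hsum]
  ring

/-- Functional representation: with `S` drawn from the first marginal and `F : α → β` having
independent coordinates distributed according to the conditional laws, `(S, F S)` has law `μ`. -/
lemma map_eval_pi_condKernel {α β γ : Type*} [Fintype α] [MeasurableSpace α]
    [MeasurableSingletonClass α] [Fintype β] [Nonempty β] [MeasurableSpace β]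
    [MeasurableSingletonClass β] [Fintype γ] [MeasurableSpace γ] [MeasurableSingletonClass γ]
    (μ : Measure (α × β)) [IsProbabilityMeasure μ] (ν : Measure γ) [IsProbabilityMeasure ν] :
    ((Measure.pi fun a => μ.condKernel a).prod (ν.prod μ.fst)).map
      (fun ω => (ω.2.2, ω.1 ω.2.2)) = μ := by
  refine Measure.ext_of_singleton fun ⟨a, b⟩ => ?_
  have hpre : (fun ω : (α → β) × (γ × α) => (ω.2.2, ω.1 ω.2.2)) ⁻¹' {(a, b)}
      = ((fun F : α → β => F a) ⁻¹' {b}) ×ˢ (Set.univ ×ˢ {a}) := by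
    ext ω
    simp only [Set.mem_preimage, Set.mem_singleton_iff, Prod.mk.injEq, Set.mem_prod,
      Set.mem_univ, true_and]
    constructor
    · rintro ⟨rfl, h⟩
      exact ⟨h, rfl⟩
    · rintro ⟨h, rfl⟩
      exact ⟨rfl, h⟩
  rw [Measure.map_apply (measurable_of_countable _) (measurableSet_singleton _), hpre,
    Measure.prod_prod, Measure.prod_prod, measure_univ, one_mul,
    (measurePreserving_eval (fun a => μ.condKernel a) a).measure_preimage
      (measurableSet_singleton b).nullMeasurableSet]
  by_cases ha : μ.fst {a} = 0
  · rw [ha, mul_zero, eq_comm]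
    refine measure_mono_null ?_ ((Measure.fst_apply (measurableSet_singleton a)).symm.trans ha)
    rintro _ rfl
    rfl
  · rw [Measure.condKernel_apply_of_ne_zero ha, mul_right_comm,
      ENNReal.inv_mul_cancel ha (measure_ne_top _ _), one_mul, Set.singleton_prod_singleton]

/-- If `H(S|Z) = 0` (i.e. `S` is a deterministic function of `Z`) and
`0 ≤ ε ≤ H(S)`, then `h_ε(P_{S,Z}) = H(Z|S) + ε`; that is, there exists `U` with
`I(U;S) ≤ ε` and `I(U;Z) = H(Z|S) + ε`, and no `U` with `I(U;S) ≤ ε` achieves more. -/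
theorem tradeoff_tight_when_S_determined_by_Z
    {σ ζ : Type} [Fintype σ] [MeasurableSpace σ] [MeasurableSingletonClass σ]
    [Fintype ζ] [MeasurableSpace ζ] [MeasurableSingletonClass ζ]
    (μ : Measure (σ × ζ)) [IsProbabilityMeasure μ]
    {ε : ℝ} (hε : 0 ≤ ε) (hεH : ε ≤ infH μ Prod.fst)
    (hdet : infCondH μ Prod.fst Prod.snd = 0) :
    hEps μ ε = infCondH μ Prod.snd Prod.fst + ε ∧
    (∃ (Ω : Type) (_ : MeasurableSpace Ω) (P : Measure Ω) (_ : IsProbabilityMeasure P)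
      (Sv : Ω → σ) (Zv : Ω → ζ) (n : ℕ) (U : Ω → Fin n),
      Measurable Sv ∧ Measurable Zv ∧ Measurable U ∧
      P.map (fun ω => (Sv ω, Zv ω)) = μ ∧
      infMI P U Sv ≤ ε ∧
      infMI P U Zv = infCondH μ Prod.snd Prod.fst + ε) ∧
    (∀ (Ω : Type) (_ : MeasurableSpace Ω) (P : Measure Ω), IsProbabilityMeasure P →
      ∀ (Sv : Ω → σ) (Zv : Ω → ζ) (n : ℕ) (U : Ω → Fin n),
        Measurable Sv → Measurable Zv → Measurable U →
        P.map (fun ω => (Sv ω, Zv ω)) = μ →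
        infMI P U Sv ≤ ε →
        infMI P U Zv ≤ infCondH μ Prod.snd Prod.fst + ε) := by
  obtain ⟨f, hf⟩ := exists_ae_eq_of_infCondH_eq_zero μ hdet
  have hpairH : infH μ (fun x : σ × ζ => x) = infH μ Prod.snd := sub_eq_zero.mp hdet
  have hswap : infH μ (fun x : σ × ζ => (x.2, x.1)) = infH μ (fun x : σ × ζ => x) :=
    infH_comp_of_injective μ (fun x : σ × ζ => x) Prod.swap_injective
  have hcond : infCondH μ Prod.snd Prod.fst = infH μ Prod.snd - infH μ Prod.fst := by
    rw [infCondH, hswap, hpairH]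
  have transfer {Ω : Type} [MeasurableSpace Ω] {P : Measure Ω} {Sv : Ω → σ} {Zv : Ω → ζ}
      (hS : Measurable Sv) (hZ : Measurable Zv) (hmap : P.map (fun ω => (Sv ω, Zv ω)) = μ) :
      infH P Sv = infH μ Prod.fst ∧ infH P Zv = infH μ Prod.snd ∧
        Sv =ᵐ[P] fun ω => f (Zv ω) := by
    have hm : Measurable fun ω => (Sv ω, Zv ω) := hS.prodMk hZ
    subst hmap
    exact ⟨(infH_map P hm Prod.fst).symm, (infH_map P hm Prod.snd).symm,
      ae_of_ae_map hm.aemeasurable hf⟩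
  have joint_le {Ω : Type} [MeasurableSpace Ω] {P : Measure Ω} [IsProbabilityMeasure P]
      {Sv : Ω → σ} {Zv : Ω → ζ} {n : ℕ} {U : Ω → Fin n} (hZ : Measurable Zv) (hU : Measurable U)
      (hSZ : Sv =ᵐ[P] fun ω => f (Zv ω)) :
      infH P (fun ω => (U ω, Sv ω)) ≤ infH P (fun ω => (U ω, Zv ω)) := by
    have hae : (fun ω => (U ω, Sv ω)) =ᵐ[P] fun ω => (U ω, f (Zv ω)) := by
      filter_upwards [hSZ] with ω hω
      rw [hω]
    rw [infH_congr_ae hae]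
    exact infH_comp_le P (hU.prodMk hZ) (fun x => (x.1, f x.2))
  have upper : ∀ (Ω : Type) (_ : MeasurableSpace Ω) (P : Measure Ω), IsProbabilityMeasure P →
      ∀ (Sv : Ω → σ) (Zv : Ω → ζ) (n : ℕ) (U : Ω → Fin n),
        Measurable Sv → Measurable Zv → Measurable U →
        P.map (fun ω => (Sv ω, Zv ω)) = μ →
        infMI P U Sv ≤ ε →
        infMI P U Zv ≤ infCondH μ Prod.snd Prod.fst + ε := by
    intro Ω _ P _ Sv Zv n U hS hZ hU hmap hle
    obtain ⟨h1, h2, h3⟩ := transfer hS hZ hmap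
    have := joint_le hZ hU h3
    rw [infMI] at hle ⊢
    linarith
  have attained : ∃ (Ω : Type) (_ : MeasurableSpace Ω) (P : Measure Ω)
      (_ : IsProbabilityMeasure P) (Sv : Ω → σ) (Zv : Ω → ζ) (n : ℕ) (U : Ω → Fin n),
      Measurable Sv ∧ Measurable Zv ∧ Measurable U ∧
      P.map (fun ω => (Sv ω, Zv ω)) = μ ∧
      infMI P U Sv ≤ ε ∧
      infMI P U Zv = infCondH μ Prod.snd Prod.fst + ε := by
    classical
    have : Nonempty ζ := μ.nonempty_of_neZero.map Prod.snd
    let p : ℝ := ε / infH μ Prod.fst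
    have hp0 : 0 ≤ p := div_nonneg hε (hε.trans hεH)
    have hp1 : p ≤ 1 := div_le_one_of_le₀ hεH (hε.trans hεH)
    have hpε : p * infH μ Prod.fst = ε := by
      by_cases h : infH μ Prod.fst = 0
      · rw [h, mul_zero]
        linarith
      · exact div_mul_cancel₀ ε h
    have := isProbabilityMeasure_coinMeasure hp0 hp1
    let R : Measure (σ → ζ) := Measure.pi fun s => μ.condKernel s
    let C : Measure (Bool × σ) := (coinMeasure p).prod μ.fst
    let _ : MeasurableSpace (Option σ) := ⊤
    let e := Fintype.equivFin ((σ → ζ) × Option σ)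
    let Sv : (σ → ζ) × (Bool × σ) → σ := fun ω => ω.2.2
    let Zv : (σ → ζ) × (Bool × σ) → ζ := fun ω => ω.1 ω.2.2
    let U : (σ → ζ) × (Bool × σ) → Fin _ := fun ω => e (ω.1, erase ω.2)
    have hmap : (R.prod C).map (fun ω => (Sv ω, Zv ω)) = μ :=
      map_eval_pi_condKernel μ (coinMeasure p)
    have hS : Measurable Sv := measurable_of_countable _
    have hZ : Measurable Zv := measurable_of_countable _
    have hU : Measurable U := measurable_of_countable _
    obtain ⟨h1, h2, h3⟩ := transfer hS hZ hmap
    have hsnd {γ : Type} [Fintype γ] (W : Bool × σ → γ) :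
        infH (R.prod C) (fun ω => W ω.2) = infH C W := by
      have := infH_map (R.prod C) measurable_snd W
      rw [Measure.map_snd_prod, measure_univ, one_smul] at this
      exact this.symm
    have hsplit {γ : Type} [Fintype γ] [MeasurableSpace γ] [MeasurableSingletonClass γ]
        (W : Bool × σ → γ) : infH (R.prod C) (fun ω => (ω.1, W ω.2))
          = infH (R.prod C) Prod.fst + infH C W := by
      have hW : Measurable W := measurable_of_countable _
      rw [← hsnd W]
      exact infH_prodMk_of_indepFun _ measurable_fst (hW.comp measurable_snd)
        (indepFun_prod measurable_id hW)
    have hHU : infH (R.prod C) U = infH (R.prod C) Prod.fst + infH C erase :=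
      (infH_comp_of_injective _ _ e.injective).trans (hsplit erase)
    have hHUS : infH (R.prod C) (fun ω => (U ω, Sv ω))
        = infH (R.prod C) Prod.fst + infH C (fun x => (erase x, x.2)) := by
      refine Eq.trans ?_ (hsplit fun x => (erase x, x.2))
      refine infH_comp_of_injective (R.prod C) (fun ω => (ω.1, (erase ω.2, ω.2.2)))
        (g := fun y => (e (y.1, y.2.1), y.2.2)) ?_
      rintro ⟨a, b, c⟩ ⟨a', b', c'⟩ h
      simp_all
    have hfst : infH μ.fst id = infH μ Prod.fst := infH_map μ measurable_fst id
    have hC : infMI C erase Prod.snd = ε := by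
      rw [← hpε, ← hfst]
      exact infMI_erase μ.fst hp0 hp1
    have hSC : infH (R.prod C) Sv = infH C Prod.snd := hsnd Prod.snd
    have hleak : infMI (R.prod C) U Sv = ε := by
      rw [← hC, infMI, infMI, hHU, hHUS, hSC]
      ring
    have hge : infH (R.prod C) (fun ω => (U ω, Zv ω)) ≤ infH (R.prod C) (fun ω => (U ω, Sv ω)) := by
      have := infH_comp_le (R.prod C) (hU.prodMk hS) (fun x => (x.1, (e.symm x.1).1 x.2))
      simpa [U, Sv, Zv] using this
    have hle := joint_le hZ hU h3
    refine ⟨_, _, R.prod C, inferInstance, Sv, Zv, _, U, hS, hZ, hU, hmap, hleak.le, ?_⟩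
    rw [infMI] at hleak ⊢
    linarith
  refine ⟨IsGreatest.csSup_eq ⟨?_, ?_⟩, attained, upper⟩
  · obtain ⟨Ω, m, P, hP, Sv, Zv, n, U, hS, hZ, hU, hmap, hle, heq⟩ := attained
    exact ⟨Ω, m, P, hP, Sv, Zv, n, U, hS, hZ, hU, hmap, hle, heq.symm⟩
  · rintro r ⟨Ω, m, P, hP, Sv, Zv, n, U, hS, hZ, hU, hmap, hle, rfl⟩
    exact upper Ω m P hP Sv Zv n U hS hZ hU hmap hle
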